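/- Let S be a nonempty finite set, W ≥ 1, and let P_1, …, P_W be probability mass functions on S such that TV(P_i, P_{i+1}) ≤ Δ for all 1 ≤ i ≤ W−1, where Δ ≥ 0. Let Q = P_W, assume the support of each P_i is contained in the support of Q, and let α = min{ Q(x) : x ∈ S, Q(x) > 0 }. Then TV( P_1 ⊗ P_2 ⊗ ⋯ ⊗ P_W , Q^{⊗W} ) ≤ Δ W^{3/2} / sqrt(6α), where ⊗ denotes the product distribution on S^W. -/

import Mathlib

open Finset

/-- Total variation distance between probability mass functions on a finite type. -/
noncomputable def tvFin {α : Type*} [Fintype α] (P Q : α → ℝ) : ℝ :=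
  (1 / 2) * ∑ a, |P a - Q a|

/-- cubic -/
noncomputable def FF (y : ℝ) : ℝ := y - y^2/2 + y^3/6

lemma FF_mono {y z : ℝ} (h : y ≤ z) : FF y ≤ FF z := by
  unfold FF
  nlinarith [mul_nonneg (sub_nonneg.2 h) (sq_nonneg (y+z-2)), mul_nonneg (sub_nonneg.2 h) (sq_nonneg (y-1)), mul_nonneg (sub_nonneg.2 h) (sq_nonneg (z-1)), mul_nonneg (sub_nonneg.2 h) (sq_nonneg (y-z))]

lemma FF_step {e K y d : ℝ} (he : 0 ≤ e) (hK : 0 ≤ K) (hy : 0 ≤ y) (h : e^2 ≤ 3*y*K)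
    (hd : e + K ≤ d) : FF y + e * (1 - FF y) ≤ FF (y + d) := by
  refine le_trans ?_ (FF_mono (by linarith : y + (e+K) ≤ y + d))
  have hy3 : 0 ≤ e * y^3 := by positivity
  have key : (e+K)^2 * (1 - y - (e+K)/3) ≤ 2 * (1 - y + y^2/2) * K := by
    by_cases hs : 1 - y - (e+K)/3 ≤ 0
    · have h1 : (e+K)^2 * (1 - y - (e+K)/3) ≤ 0 := mul_nonpos_of_nonneg_of_nonpos (sq_nonneg _) hs
      have h2 : 0 ≤ 2 * (1 - y + y^2/2) * K := by
        apply mul_nonneg _ hK; nlinarith [sq_nonneg (y-1)]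
      linarith
    · push Not at hs
      have h1 : (e+K)^2 ≤ K * (3*y + 2*(e+K)) := by nlinarith [sq_nonneg K]
      have h2 : (3*y + 2*(e+K)) * (1 - y - (e+K)/3) ≤ 2 * (1 - y + y^2/2) := by
        nlinarith [sq_nonneg ((e+K) - (2-3*y)*3/4), sq_nonneg (y - 2/5)]
      calc (e+K)^2 * (1 - y - (e+K)/3) ≤ K * (3*y + 2*(e+K)) * (1 - y - (e+K)/3) :=
            mul_le_mul_of_nonneg_right h1 hs.le
        _ = K * ((3*y + 2*(e+K)) * (1 - y - (e+K)/3)) := by ring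
        _ ≤ K * (2 * (1 - y + y^2/2)) := mul_le_mul_of_nonneg_left h2 hK
        _ = _ := by ring
  unfold FF
  nlinarith

/-- tag weights -/
noncomputable def ep (α δ k : ℝ) : ℝ := α * ((δ*k)^2/2 + (δ*k)^4/8 + (δ*k)^6/12 + 7*(δ*k)^10/24)
noncomputable def EE (α δ k : ℝ) : ℝ := α * k * ((δ*k)^2/6 + (δ*k)^4/40 + (δ*k)^6/84 + 7*(δ*k)^10/264)

lemma cs4 {a b c d : ℝ} (ha : 0 ≤ a) (hb : 0 ≤ b) (hc : 0 ≤ c) (hd : 0 ≤ d) :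
    (a+b+c+d)^2 ≤ 3 * (a/3+b/5+c/7+d/11) * (a+2*b+3*c+5*d) := by
  nlinarith [mul_nonneg ha hb, mul_nonneg ha hc, mul_nonneg ha hd, mul_nonneg hb hc, mul_nonneg hb hd, mul_nonneg hc hd, mul_nonneg hb hb, mul_nonneg hc hc, mul_nonneg hd hd]

lemma EE_step {α δ k : ℝ} (hα : 0 ≤ α) (hδ : 0 ≤ δ) (hk : 0 ≤ k) :
    FF (EE α δ k) + ep α δ k * (1 - FF (EE α δ k)) ≤ FF (EE α δ (k+1)) := by
  set K : ℝ := α * (δ^2*k/2 + 2*(δ^4*k^3/8) + 3*(δ^6*k^5/12) + 5*(7*δ^10*k^9/24)) with hKd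
  have hd : ep α δ k + K ≤ EE α δ (k+1) - EE α δ k := by
    have : EE α δ (k+1) - EE α δ k - ep α δ k - K =
      α * (δ^2*(1/6) + δ^4*((10*k^2+5*k+1)/40) + δ^6*((35*k^4+35*k^3+21*k^2+7*k+1)/84)
       + 7*δ^10*((165*k^8+330*k^7+462*k^6+462*k^5+330*k^4+165*k^3+55*k^2+11*k+1)/264)) := by
      simp only [EE, ep, hKd]; ring
    have h2 : 0 ≤ α * (δ^2*(1/6) + δ^4*((10*k^2+5*k+1)/40) + δ^6*((35*k^4+35*k^3+21*k^2+7*k+1)/84)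
       + 7*δ^10*((165*k^8+330*k^7+462*k^6+462*k^5+330*k^4+165*k^3+55*k^2+11*k+1)/264)) := by positivity
    linarith
  have h := FF_step (e := ep α δ k) (K := K) (y := EE α δ k) (d := EE α δ (k+1) - EE α δ k)
    (by unfold ep; positivity) (by positivity) (by unfold EE; positivity) ?_ hd
  · simpa using h
  · have := cs4 (a := α*(δ^2*k^2/2)) (b := α*(δ^4*k^4/8)) (c := α*(δ^6*k^6/12)) (d := α*(7*δ^10*k^10/24))
      (by positivity) (by positivity) (by positivity) (by positivity)
    calc _ = _ := ?_
      _ ≤ _ := this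
      _ = _ := ?_
    · unfold ep; ring
    · simp only [EE, hKd]; ring

lemma fin_num {x t : ℝ} (hx : 0 ≤ x) (hx1 : x ≤ 1) (ht : 0 ≤ t) (ht1 : t ≤ 1)
     : x * FF (x*(1 + 0.385*t)) ≤ x^2 + t^2/64 := by
  rcases hx.eq_or_lt with rfl | hx0
  · simp; positivity
  unfold FF
  set L : ℝ := 1 + 0.385*t with hL
  set w : ℝ := 0.5 - 0.231*x with hw
  have hw0 : 0 < w := by rw [hw]; linarith
  have h1 : w ≤ 1/2 - x*L/6 := by rw [hw, hL]; nlinarith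
  have h2 : x^3 * L^2 * w ≤ x^3 * L^2 * (1/2 - x*L/6) :=
    mul_le_mul_of_nonneg_left h1 (by positivity)
  have h3 : 0 ≤ t^2/64 - 0.385*t*x^2 + x^3 * L^2 * w := by
    set C := x^3*w with hC
    have hC0 : 0 < C := by positivity
    have hdisc : 0 ≤ w/16 - 0.385^2*x*(1-4*x*w) := by
      rw [hw]; nlinarith [sq_nonneg (x-1/4), mul_nonneg hx (sq_nonneg (x-1/4)), mul_nonneg hx (sub_nonneg.2 hx1)]
    have : 0 ≤ 4*C*(t^2/64 - 0.385*t*x^2 + x^3 * L^2 * w) := by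
      have e : 4*C*(t^2/64 - 0.385*t*x^2 + x^3 * L^2 * w) =
        (2*C + (2*0.385*C - 0.385*x^2)*t)^2 + x^3 * (w/16 - 0.385^2*x*(1-4*x*w)) * t^2 := by
        rw [hC, hL]; ring
      rw [e]; positivity
    by_contra hn
    push Not at hn
    have := mul_neg_of_pos_of_neg (by positivity : 0 < 4*C) hn
    linarith
  have : x * (x*L - (x*L)^2/2 + (x*L)^3/6) = x^2 + 0.385*t*x^2 - x^3*L^2*(1/2 - x*L/6) := by
    rw [hL]; ring
  linarith

lemma zpoly {x : ℝ} (hx : 0 ≤ x) (hx1 : x ≤ 1) :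
   1 - 2*(x/4+x^2/16+x^3/24+7*x^5/48) ≤ Real.sqrt (1-x) := by
  apply Real.le_sqrt_of_sq_le
  have h0 : 0 ≤ 1/24 - 11/192*x+97/192*x^2 := by nlinarith [sq_nonneg (x - 1/17)]
  have h1 : 0 ≤ 119/576*x^3+77/576*x^4+49/576*x^5+49/576*x^6 := by positivity
  have h : 0 ≤ x^3*(1-x)*((1/24 - 11/192*x+97/192*x^2)+(119/576*x^3+77/576*x^4+49/576*x^5+49/576*x^6)) :=
    mul_nonneg (mul_nonneg (by positivity) (by linarith)) (by linarith)
  nlinarith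

noncomputable def Psi (g a b : ℝ) : ℝ := Real.sqrt ((a+b)^2 - 4*a*b*g)

lemma psi_anti {g g' a b : ℝ} (ha : 0 ≤ a) (hb : 0 ≤ b) (h : g' ≤ g) : Psi g a b ≤ Psi g' a b := by
  apply Real.sqrt_le_sqrt
  have := mul_le_mul_of_nonneg_left h (by positivity : 0 ≤ 4*a*b)
  linarith

lemma psi_arg {g a b : ℝ} (ha : 0 ≤ a) (hb : 0 ≤ b) (h : g ≤ 1) : 0 ≤ (a+b)^2 - 4*a*b*g := by
  have := mul_le_mul_of_nonneg_left h (by positivity : 0 ≤ 4*a*b)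
  nlinarith [sq_nonneg (a-b)]

lemma sqrt_mink {A B A' B' : ℝ} (hB : 0 ≤ B) (hB' : 0 ≤ B') (hA : B ≤ A) (hA' : B' ≤ A') :
    Real.sqrt (A^2-B^2) + Real.sqrt (A'^2-B'^2) ≤ Real.sqrt ((A+A')^2-(B+B')^2) := by
  have h1 : 0 ≤ A^2-B^2 := by nlinarith
  have h2 : 0 ≤ A'^2-B'^2 := by nlinarith
  apply Real.le_sqrt_of_sq_le
  have h3 : Real.sqrt (A^2-B^2) * Real.sqrt (A'^2-B'^2) ≤ A*A' - B*B' := by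
    rw [← Real.sqrt_mul h1]
    apply Real.sqrt_le_iff.2
    constructor
    · nlinarith [mul_le_mul hA hA' hB' (hB.trans hA)]
    · nlinarith [sq_nonneg (A*B' - A'*B)]
  nlinarith [Real.sq_sqrt h1, Real.sq_sqrt h2]

lemma psi_coin {g a b v : ℝ} (ha : 0 ≤ a) (hb : 0 ≤ b) (hg : 0 ≤ g) (hg1 : g ≤ 1)
    (hv : 0 ≤ v) (hv1 : v ≤ 1) :
    Psi g (a*(1+v)) b + Psi g (a*(1-v)) b ≤ 2 * Psi (g * ((1+Real.sqrt (1-v^2))/2)) a b := by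
  have hp : 0 ≤ 1+v := by linarith
  have hm : 0 ≤ 1-v := by linarith
  have e1 : Real.sqrt (4*(a*(1+v))*b*g)^2 = 4*(a*(1+v))*b*g := Real.sq_sqrt (by positivity)
  have e2 : Real.sqrt (4*(a*(1-v))*b*g)^2 = 4*(a*(1-v))*b*g := Real.sq_sqrt (by positivity)
  have h := sqrt_mink (A := a*(1+v)+b) (B := Real.sqrt (4*(a*(1+v))*b*g))
    (A' := a*(1-v)+b) (B' := Real.sqrt (4*(a*(1-v))*b*g)) (Real.sqrt_nonneg _) (Real.sqrt_nonneg _)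
    (Real.sqrt_le_iff.2 ⟨by positivity, by linarith [psi_arg (a := a*(1+v)) (by positivity) hb hg1]⟩)
    (Real.sqrt_le_iff.2 ⟨by positivity, by linarith [psi_arg (a := a*(1-v)) (by positivity) hb hg1]⟩)
  rw [e1, e2] at h
  unfold Psi
  refine h.trans (le_of_eq ?_)
  have e3 : Real.sqrt (4*(a*(1+v))*b*g) * Real.sqrt (4*(a*(1-v))*b*g) = 4*a*b*g*Real.sqrt (1-v^2) := by
    rw [← Real.sqrt_mul (by positivity), show 4*(a*(1+v))*b*g * (4*(a*(1-v))*b*g) = (4*a*b*g)^2*(1-v^2) by ring,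
      Real.sqrt_mul (by positivity), Real.sqrt_sq (by positivity)]
  have e4 : (2:ℝ) = Real.sqrt (2^2) := by rw [Real.sqrt_sq (by norm_num)]
  rw [e4, ← Real.sqrt_mul (by positivity)]
  congr 1
  nlinarith

lemma psi_mix {g h a b θ : ℝ} (ha : 0 ≤ a) (hb : 0 ≤ b) (hg1 : g ≤ 1) (hh1 : h ≤ 1)
    (h0 : 0 ≤ θ) (h1 : θ ≤ 1) :
    (1-θ) * Psi g a b + θ * Psi h a b ≤ Psi ((1-θ)*g+θ*h) a b := by
  have := Real.strictConcaveOn_sqrt.concaveOn.2 (Set.mem_Ici.2 (psi_arg ha hb hg1))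
    (Set.mem_Ici.2 (psi_arg ha hb hh1)) (sub_nonneg.2 h1) h0 (by ring : (1 - θ) + θ = 1)
  simp only [smul_eq_mul] at this
  unfold Psi
  refine this.trans (le_of_eq ?_)
  congr 1; ring

section
variable {S : Type*} [Fintype S]

noncomputable def NN (R : ℕ → S → ℝ) (Q : S → ℝ) : ℕ → ℝ → ℝ → ℝ
  | 0, a, b => |a - b|
  | n+1, a, b => ∑ x, NN R Q n (a * R n x) (b * Q x)

lemma NN_smul (R : ℕ → S → ℝ) (Q : S → ℝ) (n : ℕ) : ∀ (c a b : ℝ), 0 ≤ c →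
    NN R Q n (c*a) (c*b) = c * NN R Q n a b := by
  induction n with
  | zero => intro c a b hc; simp only [NN]; rw [← mul_sub, abs_mul, abs_of_nonneg hc]
  | succ n ih => intro c a b hc; simp only [NN, mul_assoc, Finset.mul_sum]; simp_rw [ih _ _ _ hc]

lemma NN_add (R : ℕ → S → ℝ) (Q : S → ℝ) (n : ℕ) : ∀ (a a' b b' : ℝ),
    NN R Q n (a+a') (b+b') ≤ NN R Q n a b + NN R Q n a' b' := by
  induction n with
  | zero => intro a a' b b'; simp only [NN]; rw [add_sub_add_comm]; exact abs_add_le _ _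
  | succ n ih =>
    intro a a' b b'; simp only [NN, add_mul]; rw [← Finset.sum_add_distrib]
    exact Finset.sum_le_sum fun x _ => ih _ _ _ _

lemma NN_le (R : ℕ → S → ℝ) (Q : S → ℝ) (hR : ∀ k x, 0 ≤ R k x) (hQ : ∀ x, 0 ≤ Q x)
    (hRs : ∀ k, ∑ x, R k x = 1) (hQs : ∑ x, Q x = 1) (n : ℕ) : ∀ (a b : ℝ), 0 ≤ a → 0 ≤ b →
    NN R Q n a b ≤ a + b := by
  induction n with
  | zero => intro a b ha hb; simp only [NN]; rw [abs_le]; constructor <;> linarith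
  | succ n ih =>
    intro a b ha hb; simp only [NN]
    calc _ ≤ ∑ x, (a * R n x + b * Q x) :=
          Finset.sum_le_sum fun x _ => ih _ _ (mul_nonneg ha (hR _ _)) (mul_nonneg hb (hQ _))
      _ = a + b := by rw [Finset.sum_add_distrib, ← Finset.mul_sum, ← Finset.mul_sum, hRs, hQs]; ring

lemma NN_eq (R : ℕ → S → ℝ) (Q : S → ℝ) (n : ℕ) : ∀ (a b : ℝ),
    NN R Q n a b = ∑ s : Fin n → S, |a * ∏ i : Fin n, R (n-1-(i:ℕ)) (s i) - b * ∏ i, Q (s i)| := by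
  induction n with
  | zero => intro a b; simp [NN]
  | succ n ih =>
    intro a b
    simp only [NN]
    rw [← (Fin.consEquiv (fun _ : Fin (n+1) => S)).sum_comp, Fintype.sum_prod_type]
    refine Finset.sum_congr rfl fun x _ => ?_
    rw [ih]
    refine Finset.sum_congr rfl fun s _ => ?_
    simp only [Fin.consEquiv, Equiv.coe_fn_mk, Fin.prod_univ_succ, Fin.cons_zero, Fin.cons_succ, Fin.val_zero, Fin.val_succ]
    have : ∀ i : Fin n, n - ((i:ℕ)+1) = n - 1 - i := fun i => by omega
    simp only [mul_assoc, Nat.add_sub_cancel, Nat.sub_zero, this]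

lemma tv_pos {R Q : S → ℝ} (hRs : ∑ x, R x = 1) (hQs : ∑ x, Q x = 1) :
    ∑ x, (|R x - Q x| + (R x - Q x))/2 = tvFin R Q ∧ ∑ x, (|R x - Q x| - (R x - Q x))/2 = tvFin R Q := by
  constructor
  · rw [← Finset.sum_div, Finset.sum_add_distrib, Finset.sum_sub_distrib, hRs, hQs]; unfold tvFin; ring
  · rw [← Finset.sum_div, Finset.sum_sub_distrib, Finset.sum_sub_distrib, hRs, hQs]; unfold tvFin; ring

lemma abs_le_tv {R Q : S → ℝ} (hRs : ∑ x, R x = 1) (hQs : ∑ x, Q x = 1) (x : S) :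
    |R x - Q x| ≤ tvFin R Q := by
  obtain ⟨h1, h2⟩ := tv_pos hRs hQs
  have n1 : ∀ y, 0 ≤ (|R y - Q y| + (R y - Q y))/2 := fun y => by linarith [neg_abs_le (R y - Q y)]
  have n2 : ∀ y, 0 ≤ (|R y - Q y| - (R y - Q y))/2 := fun y => by linarith [le_abs_self (R y - Q y)]
  have a1 := Finset.single_le_sum (fun y _ => n1 y) (Finset.mem_univ x)
  have a2 := Finset.single_le_sum (fun y _ => n2 y) (Finset.mem_univ x)
  rw [h1] at a1; rw [h2] at a2
  rcases abs_cases (R x - Q x) with h | h <;> linarith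

lemma tag_nonneg {R Q : S → ℝ} (hRs : ∑ x, R x = 1) (hQs : ∑ x, Q x = 1)
    {α : ℝ} (hα : 0 < α) (hs : ∀ x, Q x = 0 → R x = 0) (hq : ∀ x, Q x ≠ 0 → α ≤ Q x)
    (hτ : 0 < tvFin R Q) (x : S) : 0 ≤ Q x - |R x - Q x| * (α / tvFin R Q) := by
  by_cases h : Q x = 0
  · simp [h, hs x h]
  · have h1 := abs_le_tv hRs hQs x
    have : |R x - Q x| * (α / tvFin R Q) ≤ tvFin R Q * (α / tvFin R Q) :=
      mul_le_mul_of_nonneg_right h1 (by positivity)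
    rw [mul_div_cancel₀ _ hτ.ne'] at this
    linarith [hq x h]

lemma tag_sum {R Q : S → ℝ} (hQs : ∑ x, Q x = 1)
    {α : ℝ} (hτ : 0 < tvFin R Q) : ∑ x, (Q x - |R x - Q x| * (α / tvFin R Q)) = 1 - 2*α := by
  rw [Finset.sum_sub_distrib, ← Finset.sum_mul, hQs,
    show ∑ x, |R x - Q x| = 2 * tvFin R Q by unfold tvFin; ring]
  field_simp

lemma coin_decomp {R Q : S → ℝ} (hRs : ∑ x, R x = 1) (hQs : ∑ x, Q x = 1)
    {α : ℝ} (hα : 0 < α) (hs : ∀ x, Q x = 0 → R x = 0) (hq : ∀ x, Q x ≠ 0 → α ≤ Q x)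
    (hτ : 0 < tvFin R Q) (f : ℝ → ℝ → ℝ) (hf : ∀ c a b, 0 ≤ c → f (c*a) (c*b) = c * f a b)
    (hadd : ∀ a a' b b', f (a+a') (b+b') ≤ f a b + f a' b') (a b : ℝ) :
    ∑ x, f (a * R x) (b * Q x) ≤ (1-2*α) * f a b + α * f (a*(1+tvFin R Q/α)) b
      + α * f (a*(1-tvFin R Q/α)) b := by
  obtain ⟨h1, h2⟩ := tv_pos hRs hQs
  set τ := tvFin R Q with hτd
  have hpt : ∀ x, f (a * R x) (b * Q x) ≤ (Q x - |R x - Q x| * (α / τ)) * f a b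
     + ((|R x - Q x| + (R x - Q x))/2) * ((α/τ) * f (a*(1+τ/α)) b)
     + ((|R x - Q x| - (R x - Q x))/2) * ((α/τ) * f (a*(1-τ/α)) b) := by
    intro x
    have n0 := tag_nonneg hRs hQs hα hs hq hτ x
    have n1 : 0 ≤ (|R x - Q x| + (R x - Q x))/2 := by linarith [neg_abs_le (R x - Q x)]
    have n2 : 0 ≤ (|R x - Q x| - (R x - Q x))/2 := by linarith [le_abs_self (R x - Q x)]
    rw [← hτd] at n0
    rw [← mul_assoc, ← mul_assoc, ← hf _ _ _ n0, ← hf _ _ _ (by positivity), ← hf _ _ _ (by positivity)]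
    refine le_trans (le_of_eq ?_) ((hadd _ _ _ _).trans (add_le_add (hadd _ _ _ _) le_rfl))
    congr 1
    · field_simp; ring
    · field_simp; ring
  refine (Finset.sum_le_sum fun x _ => hpt x).trans (le_of_eq ?_)
  rw [Finset.sum_add_distrib, Finset.sum_add_distrib, ← Finset.sum_mul, ← Finset.sum_mul, ← Finset.sum_mul,
    h1, h2, tag_sum hQs hτ]
  field_simp

lemma coupling_decomp {R Q : S → ℝ} (hR : ∀ x, 0 ≤ R x) (hQ : ∀ x, 0 ≤ Q x)
    (hRs : ∑ x, R x = 1) (hQs : ∑ x, Q x = 1)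
    (f : ℝ → ℝ → ℝ) (hf : ∀ c a b, 0 ≤ c → f (c*a) (c*b) = c * f a b)
    (hadd : ∀ a a' b b', f (a+a') (b+b') ≤ f a b + f a' b') :
    ∑ x, f (1 * R x) (1 * Q x) ≤ (1-tvFin R Q) * f 1 1 + tvFin R Q * (f 1 0 + f 0 1) := by
  obtain ⟨h1, h2⟩ := tv_pos hRs hQs
  set τ := tvFin R Q with hτd
  have hpt : ∀ x, f (1 * R x) (1 * Q x) ≤ (Q x - (|R x - Q x| - (R x - Q x))/2) * f 1 1
     + ((|R x - Q x| + (R x - Q x))/2) * f 1 0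
     + ((|R x - Q x| - (R x - Q x))/2) * f 0 1 := by
    intro x
    have n0 : 0 ≤ Q x - (|R x - Q x| - (R x - Q x))/2 := by
      rcases abs_cases (R x - Q x) with h | h <;> linarith [hR x, hQ x]
    have n1 : 0 ≤ (|R x - Q x| + (R x - Q x))/2 := by linarith [neg_abs_le (R x - Q x)]
    have n2 : 0 ≤ (|R x - Q x| - (R x - Q x))/2 := by linarith [le_abs_self (R x - Q x)]
    rw [← hf _ _ _ n0, ← hf _ _ _ n1, ← hf _ _ _ n2]
    refine le_trans (le_of_eq ?_) ((hadd _ _ _ _).trans (add_le_add (hadd _ _ _ _) le_rfl))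
    congr 1 <;> ring
  refine (Finset.sum_le_sum fun x _ => hpt x).trans (le_of_eq ?_)
  rw [Finset.sum_add_distrib, Finset.sum_add_distrib, ← Finset.sum_mul, ← Finset.sum_mul, ← Finset.sum_mul,
    h1, h2, Finset.sum_sub_distrib, h2, hQs]
  ring

lemma tv_zero {R Q : S → ℝ} (h : tvFin R Q ≤ 0) : R = Q := by
  funext x
  have h1 : ∑ x, |R x - Q x| ≤ 0 := by unfold tvFin at h; linarith
  have h2 := Finset.single_le_sum (f := fun x => |R x - Q x|) (fun y _ => abs_nonneg _) (Finset.mem_univ x)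
  have : |R x - Q x| ≤ 0 := h2.trans h1
  exact sub_eq_zero.1 (abs_nonpos_iff.1 this)

lemma NN_same (R : ℕ → S → ℝ) (Q : S → ℝ) (n : ℕ) (h : R n = Q) (hQ : ∀ x, 0 ≤ Q x)
    (hQs : ∑ x, Q x = 1) (a b : ℝ) : NN R Q (n+1) a b = NN R Q n a b := by
  simp only [NN, h]
  simp_rw [mul_comm a, mul_comm b, NN_smul R Q n _ _ _ (hQ _)]
  rw [← Finset.sum_mul, hQs, one_mul]

noncomputable def gg (α δ : ℝ) : ℕ → ℝ
  | 0 => 1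
  | n+1 => gg α δ n * (1 - ep α δ n)

end
section
variable {S : Type*} [Fintype S]

lemma ep_bd {α δ k : ℝ} (hα : 0 ≤ α) (hα1 : α ≤ 1) (h0 : 0 ≤ δ*k) (h1 : δ*k ≤ 1) :
    0 ≤ ep α δ k ∧ ep α δ k ≤ 1 := by
  unfold ep
  refine ⟨by positivity, ?_⟩
  have e2 := pow_le_one₀ h0 h1 (n := 2)
  have e4 := pow_le_one₀ h0 h1 (n := 4)
  have e6 := pow_le_one₀ h0 h1 (n := 6)
  have e10 := pow_le_one₀ h0 h1 (n := 10)
  have : (δ*k)^2/2 + (δ*k)^4/8 + (δ*k)^6/12 + 7*(δ*k)^10/24 ≤ 1 := by linarith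
  calc _ ≤ α * 1 := mul_le_mul_of_nonneg_left this hα
    _ ≤ 1 := by linarith

lemma gg_bd {α δ : ℝ} (hα : 0 ≤ α) (hα1 : α ≤ 1) (hδ : 0 ≤ δ) (n : ℕ)
    (h : ∀ k < n, δ * (k:ℝ) ≤ 1) : 0 ≤ gg α δ n ∧ gg α δ n ≤ 1 ∧ 1 - gg α δ n ≤ FF (EE α δ n) := by
  induction n with
  | zero => simp [gg, FF, EE]
  | succ n ih =>
    obtain ⟨i0, i1, i2⟩ := ih fun k hk => h k (by omega)
    obtain ⟨e0, e1⟩ := ep_bd (k := (n:ℝ)) hα hα1 (by positivity) (h n (by omega))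
    simp only [gg]
    refine ⟨mul_nonneg i0 (by linarith), by nlinarith, ?_⟩
    have := EE_step (k := (n:ℝ)) hα hδ (Nat.cast_nonneg n)
    push_cast
    nlinarith

lemma NN_psi {R : ℕ → S → ℝ} {Q : S → ℝ} (hQ : ∀ x, 0 ≤ Q x)
    (hRs : ∀ k, ∑ x, R k x = 1) (hQs : ∑ x, Q x = 1) {α Δ : ℝ} (hα : 0 < α) (hα1 : α ≤ 1)
    (hΔ : 0 ≤ Δ) (hs : ∀ k x, Q x = 0 → R k x = 0) (hq : ∀ x, Q x ≠ 0 → α ≤ Q x)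
    (htv : ∀ k : ℕ, tvFin (R k) Q ≤ k * Δ) (n : ℕ) (h : ∀ k < n, Δ/α * (k:ℝ) ≤ 1) :
    ∀ a b : ℝ, 0 ≤ a → 0 ≤ b → NN R Q n a b ≤ Psi (gg α (Δ/α) n) a b := by
  induction n with
  | zero =>
    intro a b ha hb
    simp only [NN, gg, Psi]
    apply Real.le_sqrt_of_sq_le
    rw [sq_abs]; nlinarith
  | succ n ih =>
    intro a b ha hb
    have h' : ∀ k < n, Δ/α * (k:ℝ) ≤ 1 := fun k hk => h k (by omega)
    have ih := ih h'
    have hδ : 0 ≤ Δ/α := by positivity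
    obtain ⟨g0, g1, -⟩ := gg_bd hα.le hα1 hδ n h'
    have hn := h n (by omega)
    obtain ⟨e0, e1⟩ := ep_bd (k := (n:ℝ)) hα.le hα1 (by positivity) hn
    set g := gg α (Δ/α) n with hg
    have hgs : gg α (Δ/α) (n+1) = g * (1 - ep α (Δ/α) n) := rfl
    rw [hgs]
    by_cases hτ : tvFin (R n) Q ≤ 0
    · rw [NN_same R Q n (tv_zero hτ) hQ hQs]
      exact (ih a b ha hb).trans (psi_anti ha hb (by nlinarith))
    push Not at hτ
    have h2α : 0 ≤ 1 - 2*α := by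
      rw [← tag_sum (R := R n) hQs hτ]
      exact Finset.sum_nonneg fun x _ => tag_nonneg (hRs n) hQs hα (hs n) hq hτ x
    have hd := coin_decomp (hRs n) hQs hα (hs n) hq hτ (NN R Q n) (fun c a b => NN_smul R Q n c a b)
      (NN_add R Q n) a b
    set v := tvFin (R n) Q / α with hv
    have hv0 : 0 ≤ v := by positivity
    have hvu : v ≤ Δ/α * n := by
      rw [hv, div_mul_eq_mul_div]; gcongr; linarith [htv n]
    have hv1 : v ≤ 1 := hvu.trans hn
    have c1 := ih a b ha hb
    have c2 := ih (a*(1+v)) b (by positivity) hb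
    have c3 := ih (a*(1-v)) b (mul_nonneg ha (by linarith)) hb
    have cc := psi_coin ha hb g0 g1 hv0 hv1
    set ρ := (1+Real.sqrt (1-v^2))/2 with hρ
    have hsq1 : Real.sqrt (1-v^2) ≤ 1 := Real.sqrt_le_one.2 (by nlinarith)
    have hρ1 : ρ ≤ 1 := by rw [hρ]; linarith
    have hm := psi_mix (g := g) (h := g*ρ) (θ := 2*α) ha hb g1 (by nlinarith) (by linarith) (by linarith)
    have hz := zpoly (x := v^2) (by positivity) (by nlinarith)
    have hep : 2*α*(1-ρ) ≤ ep α (Δ/α) n := by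
      have : 2*α*(1-ρ) ≤ α * (v^2/2 + v^4/8 + v^6/12 + 7*v^10/24) := by
        have : 1 - ρ ≤ (v^2/2 + v^4/8 + v^6/12 + 7*v^10/24)/2 := by rw [hρ]; ring_nf at hz ⊢; linarith
        nlinarith
      refine this.trans ?_
      unfold ep
      gcongr
    calc NN R Q (n+1) a b ≤ _ := hd
      _ ≤ (1-2*α) * Psi g a b + α * Psi g (a*(1+v)) b + α * Psi g (a*(1-v)) b := by gcongr
      _ ≤ (1-2*α) * Psi g a b + 2*α*Psi (g*ρ) a b := by nlinarith
      _ ≤ _ := hm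
      _ ≤ _ := psi_anti ha hb (by linarith [mul_le_mul_of_nonneg_left hep g0])

lemma tv_le_one {R Q : S → ℝ} (hR : ∀ x, 0 ≤ R x) (hQ : ∀ x, 0 ≤ Q x)
    (hRs : ∑ x, R x = 1) (hQs : ∑ x, Q x = 1) : tvFin R Q ≤ 1 := by
  rw [← (tv_pos hRs hQs).2, ← hQs]
  refine Finset.sum_le_sum fun x _ => ?_
  rcases abs_cases (R x - Q x) with h | h <;> linarith [hR x, hQ x]

lemma coin_num {α Δ N s h : ℝ} (hα : 0 < α) (hΔ : 0 < Δ) (hN : 0 < N) (hs : 0 ≤ s) (hs1 : s ≤ 1)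
    (hs2 : s^2 = Δ^2*N^3/(6*α)) (hu : Δ/α*N ≤ 1) (hh : h ≤ FF (EE α (Δ/α) N)) :
    α * Real.sqrt ((Δ/α*N)^2 + 4*h) ≤ 2*α*s + 3/2*s/N := by
  set u := Δ/α*N with hud
  have hu0 : 0 < u := by positivity
  have hX : s^2 = α*N*u^2/6 := by rw [hs2, hud]; field_simp
  have hX0 : 0 < s^2 := by rw [hX]; positivity
  have hL : EE α (Δ/α) N ≤ s^2 * (1 + 0.385*u^2) := by
    rw [hX]; unfold EE; rw [← hud]
    have t4 := pow_le_pow_of_le_one hu0.le hu (show 4 ≤ 6 by norm_num)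
    have t10 := pow_le_pow_of_le_one hu0.le hu (show 4 ≤ 10 by norm_num)
    have t6 := pow_le_pow_of_le_one hu0.le hu (show 4 ≤ 6 by norm_num)
    have : u^2/6 + u^4/40 + u^6/84 + 7*u^10/264 ≤ u^2/6*(1+0.385*u^2) := by
      have : 0 ≤ u^4 := by positivity
      nlinarith
    calc _ ≤ α*N*(u^2/6*(1+0.385*u^2)) := mul_le_mul_of_nonneg_left this (by positivity)
      _ = _ := by ring
  have hF := fin_num (x := s^2) (t := u^2) hX0.le (by nlinarith) (by positivity) (by nlinarith)
  have hh2 : s^2*h ≤ (s^2)^2 + (u^2)^2/64 :=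
    (mul_le_mul_of_nonneg_left (hh.trans (FF_mono hL)) hX0.le).trans hF
  have key : Real.sqrt (u^2+4*h) ≤ 2*s + 3/2*s/(α*N) := by
    apply Real.sqrt_le_iff.2
    refine ⟨by positivity, ?_⟩
    have e : (2*s + 3/2*s/(α*N))^2 = 4*s^2 + u^2 + (u^2)^2/(16*s^2) := by
      have : (2*s + 3/2*s/(α*N))^2 = s^2*(4 + 6/(α*N) + 9/4/(α*N)^2) := by field_simp; ring
      rw [this, hX]; field_simp; ring
    rw [e]
    have : h ≤ s^2 + (u^2)^2/(64*s^2) := by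
      have e2 : s^2 + (u^2)^2/(64*s^2) = ((s^2)^2 + (u^2)^2/64)/s^2 := by field_simp
      rw [e2, le_div_iff₀ hX0]; linarith
    have e3 : (u^2)^2/(16*s^2) = 4*((u^2)^2/(64*s^2)) := by field_simp; norm_num
    linarith
  calc _ ≤ α*(2*s + 3/2*s/(α*N)) := mul_le_mul_of_nonneg_left key hα.le
    _ = _ := by field_simp

lemma main_ind {R : ℕ → S → ℝ} {Q : S → ℝ} (hR : ∀ k x, 0 ≤ R k x) (hQ : ∀ x, 0 ≤ Q x)
    (hRs : ∀ k, ∑ x, R k x = 1) (hQs : ∑ x, Q x = 1) {α Δ : ℝ} (hα : 0 < α) (hα1 : α ≤ 1)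
    (hΔ : 0 ≤ Δ) (hs : ∀ k x, Q x = 0 → R k x = 0) (hq : ∀ x, Q x ≠ 0 → α ≤ Q x)
    (htv : ∀ k : ℕ, tvFin (R k) Q ≤ k * Δ) (n : ℕ) :
    NN R Q n 1 1 ≤ 2 * (Δ / Real.sqrt (6*α) * (n * Real.sqrt n)) := by
  induction n with
  | zero => simp [NN]
  | succ n ih =>
    have hc : 0 ≤ Δ / Real.sqrt (6*α) := by positivity
    rcases Nat.eq_zero_or_pos n with rfl | hn
    · rw [NN_same R Q 0 (tv_zero (by simpa using htv 0)) hQ hQs]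
      simp only [NN]; simp; positivity
    have hN : (0:ℝ) < n := by exact_mod_cast hn
    set N : ℝ := (Nat.cast n : ℝ) with hNd
    set s := Δ / Real.sqrt (6*α) * (N * Real.sqrt N) with hsd
    set s' := Δ / Real.sqrt (6*α) * (((n+1:ℕ):ℝ) * Real.sqrt ((n+1:ℕ):ℝ)) with hsd'
    have hs0 : 0 ≤ s := by positivity
    have hs2 : s^2 = Δ^2*N^3/(6*α) := by
      rw [hsd, mul_pow, div_pow, mul_pow, Real.sq_sqrt (by positivity), Real.sq_sqrt (by positivity)]; ring
    have hss : s + 3/2*s/N ≤ s' := by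
      have h1 : (N + 3/2) * Real.sqrt N ≤ (N+1) * Real.sqrt (N+1) := by
        refine (sq_le_sq₀ (by positivity) (by positivity)).1 ?_
        rw [mul_pow, mul_pow, Real.sq_sqrt hN.le, Real.sq_sqrt (by positivity)]
        nlinarith
      have e1 : s + 3/2*s/N = Δ / Real.sqrt (6*α) * ((N+3/2) * Real.sqrt N) := by
        rw [hsd]; field_simp
      rw [e1, hsd']; push_cast
      exact mul_le_mul_of_nonneg_left h1 hc
    have hss1 : s ≤ s' := by
      have : 0 ≤ 3/2*s/N := by positivity
      linarith
    by_cases hs1 : 1 ≤ s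
    · have := NN_le R Q hR hQ hRs hQs (n+1) 1 1 zero_le_one zero_le_one
      linarith
    push Not at hs1
    by_cases hτ : tvFin (R n) Q ≤ 0
    · rw [NN_same R Q n (tv_zero hτ) hQ hQs]; linarith
    push Not at hτ
    have htn := htv n
    have hΔ0 : 0 < Δ := by
      by_contra hneg
      have : Δ = 0 := by linarith
      rw [this] at htn; linarith
    by_cases hu : 1 ≤ Δ/α*N
    · have hd := coupling_decomp (hR n) hQ (hRs n) hQs (NN R Q n) (fun c a b => NN_smul R Q n c a b) (NN_add R Q n)
      have h10 := NN_le R Q hR hQ hRs hQs n 1 0 zero_le_one le_rfl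
      have h01 := NN_le R Q hR hQ hRs hQs n 0 1 le_rfl zero_le_one
      have ht1 := tv_le_one (hR n) hQ (hRs n) hQs
      set τ := tvFin (R n) Q
      have hspos : 0 < s := by positivity
      have hb : N*Δ*(1-s) ≤ 3/2*s/N := by
        rw [le_div_iff₀ hN]
        have hu' : α ≤ Δ*N := by
          rw [div_mul_eq_mul_div, le_div_iff₀ hα] at hu; linarith
        have h4 : 4*α*(s*(1-s)) ≤ Δ*N := by nlinarith [sq_nonneg (2*s-1)]
        have h5 : s^2*(6*α) = Δ^2*N^3 := by rw [hs2]; field_simp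
        have h6 : (N*Δ*(1-s)*N)*(4*α*s) ≤ (3/2*s)*(4*α*s) := by
          have := mul_le_mul_of_nonneg_left h4 (by positivity : 0 ≤ N^2*Δ)
          nlinarith
        exact le_of_mul_le_mul_right h6 (by positivity)
      have hb2 : τ*(1-s) ≤ N*Δ*(1-s) := mul_le_mul_of_nonneg_right htn (by linarith)
      have h7 : (1-τ)*NN R Q n 1 1 ≤ (1-τ)*(2*s) := mul_le_mul_of_nonneg_left ih (by linarith)
      have h8 : τ*(NN R Q n 1 0 + NN R Q n 0 1) ≤ τ*2 := mul_le_mul_of_nonneg_left (by linarith) hτ.le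
      have h9 : NN R Q (n+1) 1 1 ≤ (1-τ)*NN R Q n 1 1 + τ*(NN R Q n 1 0 + NN R Q n 0 1) := hd
      linarith
    push Not at hu
    have hall : ∀ k < n, Δ/α * (k:ℝ) ≤ 1 := fun k hk => by
      have : (k:ℝ) ≤ N := by rw [hNd]; exact_mod_cast hk.le
      have := mul_le_mul_of_nonneg_left this (by positivity : 0 ≤ Δ/α)
      linarith
    obtain ⟨g0, g1, g2⟩ := gg_bd hα.le hα1 (by positivity : 0 ≤ Δ/α) n hall
    have hpsi := NN_psi hQ hRs hQs hα hα1 hΔ hs hq htv n hall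
    have h2α : 0 ≤ 1 - 2*α := by
      rw [← tag_sum (R := R n) hQs hτ]
      exact Finset.sum_nonneg fun x _ => tag_nonneg (hRs n) hQs hα (hs n) hq hτ x
    have hd := coin_decomp (hRs n) hQs hα (hs n) hq hτ (NN R Q n) (fun c a b => NN_smul R Q n c a b)
      (NN_add R Q n) 1 1
    have hnum := coin_num hα hΔ0 hN hs0 hs1.le hs2 hu.le g2
    set v := tvFin (R n) Q / α with hv
    have hv0 : 0 ≤ v := by positivity
    have hvu : v ≤ Δ/α * N := by
      rw [hv, div_mul_eq_mul_div]; gcongr; linarith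
    have c2 := hpsi (1*(1+v)) 1 (by positivity) zero_le_one
    have c3 := hpsi (1*(1-v)) 1 (by linarith) zero_le_one
    set g := gg α (Δ/α) n with hg
    have cc : Psi g (1*(1+v)) 1 + Psi g (1*(1-v)) 1 ≤ 2*Real.sqrt ((Δ/α*N)^2 + 4*(1-g)) := by
      have a1 : 0 ≤ v^2 + 4*(1+v)*(1-g) := by
        have := mul_nonneg (by linarith : 0 ≤ 4*(1+v)) (sub_nonneg.2 g1); positivity
      have a2 : 0 ≤ v^2 + 4*(1-v)*(1-g) := by
        have := mul_nonneg (by linarith : 0 ≤ 4*(1-v)) (sub_nonneg.2 g1); nlinarith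
      have cv := Real.strictConcaveOn_sqrt.concaveOn.2 (Set.mem_Ici.2 a1) (Set.mem_Ici.2 a2)
        (by norm_num : (0:ℝ) ≤ 1/2) (by norm_num : (0:ℝ) ≤ 1/2) (by norm_num)
      simp only [smul_eq_mul] at cv
      have e1 : Psi g (1*(1+v)) 1 = Real.sqrt (v^2 + 4*(1+v)*(1-g)) := by unfold Psi; congr 1; ring
      have e2 : Psi g (1*(1-v)) 1 = Real.sqrt (v^2 + 4*(1-v)*(1-g)) := by unfold Psi; congr 1; ring
      have e3 : Real.sqrt (1/2*(v^2 + 4*(1+v)*(1-g)) + 1/2*(v^2 + 4*(1-v)*(1-g))) ≤ Real.sqrt ((Δ/α*N)^2 + 4*(1-g)) := by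
        apply Real.sqrt_le_sqrt
        have := pow_le_pow_left₀ hv0 hvu 2
        linarith
      rw [e1, e2]; linarith
    have h9 : NN R Q (n+1) 1 1 ≤ (1-2*α)*NN R Q n 1 1 + α*NN R Q n (1*(1+v)) 1 + α*NN R Q n (1*(1-v)) 1 := hd
    have h7 : (1-2*α)*NN R Q n 1 1 ≤ (1-2*α)*(2*s) := mul_le_mul_of_nonneg_left ih h2α
    have h8 : α*(NN R Q n (1*(1+v)) 1 + NN R Q n (1*(1-v)) 1) ≤ α*(2*Real.sqrt ((Δ/α*N)^2 + 4*(1-g))) :=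
      mul_le_mul_of_nonneg_left (by linarith) hα.le
    linarith

lemma tv_tri {A B C : S → ℝ} : tvFin A C ≤ tvFin A B + tvFin B C := by
  unfold tvFin
  rw [← mul_add, ← Finset.sum_add_distrib]
  have := Finset.sum_le_sum (s := univ) fun x _ => abs_sub_le (A x) (B x) (C x)
  linarith
end

theorem window_product_TV_bound
    {S : Type*} [Fintype S] [Nonempty S] (W : ℕ) (hW : 1 ≤ W)
    (P : Fin W → S → ℝ) (Δ : ℝ) (hΔ : 0 ≤ Δ)
    (hPnn : ∀ i x, 0 ≤ P i x) (hPsum : ∀ i, ∑ x, P i x = 1)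
    (hdrift : ∀ i : Fin W, ∀ hi : (i : ℕ) + 1 < W,
      tvFin (P i) (P ⟨(i : ℕ) + 1, hi⟩) ≤ Δ)
    (Q : S → ℝ) (hQ : Q = P ⟨W - 1, by omega⟩)
    (hsupp : ∀ i x, Q x = 0 → P i x = 0)
    (α : ℝ) (hα : IsLeast {t : ℝ | ∃ x, Q x = t ∧ 0 < t} α) :
    tvFin (fun s : Fin W → S => ∏ i, P i (s i))
        (fun s : Fin W → S => ∏ i, Q (s i)) ≤
      Δ * (W : ℝ) ^ ((3 : ℝ) / 2) / Real.sqrt (6 * α) := by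
  have hQnn : ∀ x, 0 ≤ Q x := fun x => by rw [hQ]; exact hPnn _ _
  have hQs : ∑ x, Q x = 1 := by rw [hQ]; exact hPsum _
  obtain ⟨⟨x0, hx0, hα0⟩, hmin⟩ := hα
  have hα1 : α ≤ 1 := by
    rw [← hx0, ← hQs]
    exact Finset.single_le_sum (fun y _ => hQnn y) (Finset.mem_univ x0)
  have hq : ∀ x, Q x ≠ 0 → α ≤ Q x := fun x hx =>
    hmin ⟨x, rfl, lt_of_le_of_ne (hQnn x) (Ne.symm hx)⟩
  let R : ℕ → S → ℝ := fun k => P ⟨W - 1 - k, by omega⟩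
  have htv : ∀ k : ℕ, tvFin (R k) Q ≤ k * Δ := by
    intro k
    induction k with
    | zero => simp [R, hQ, tvFin]
    | succ k ih =>
      by_cases hk : k + 1 ≤ W - 1
      · have h1 := hdrift ⟨W - 1 - (k+1), by omega⟩ (by simp only; omega)
        have e : (⟨W - 1 - (k+1) + 1, by omega⟩ : Fin W) = ⟨W - 1 - k, by omega⟩ := by
          ext; simp only; omega
        simp only [e] at h1
        have := tv_tri (A := R (k+1)) (B := R k) (C := Q)
        have h1' : tvFin (R (k+1)) (R k) ≤ Δ := h1
        push_cast; linarith
      · have e : R (k+1) = R k := by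
          simp only [R]; congr 2; omega
        rw [e]; push_cast; linarith
  have hm := main_ind (R := R) (Q := Q) (fun k x => hPnn _ _) hQnn (fun k => hPsum _) hQs hα0 hα1 hΔ
    (fun k x => hsupp _ x) hq htv W
  rw [NN_eq] at hm
  have hpe : ∀ i : Fin W, R (W - 1 - (i:ℕ)) = P i := fun i => by
    simp only [R]; congr 1; ext; simp only; omega
  simp only [hpe, one_mul] at hm
  unfold tvFin
  have hp : (W:ℝ) ^ ((3:ℝ)/2) = W * Real.sqrt W := by
    have hW0 : (0:ℝ) < W := by exact_mod_cast hW
    rw [show (3:ℝ)/2 = 1 + 1/2 by norm_num, Real.rpow_add hW0, Real.rpow_one, Real.sqrt_eq_rpow]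
  rw [hp, mul_div_right_comm]
  linarith
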